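/- Let G be a simple graph on vertex set {1,…,r} with nonempty edge set and let H be an induced subgraph of G with ν₀(H) = ν₀(G). Then sdst(J(G)) ≤ sdst(J(H)), where J(H) is the cover ideal of H in the polynomial ring on the variables indexed by the vertices of H. -/

import Mathlib

open SimpleGraph

namespace DS

variable {V : Type*}

/-- The set of edges of a matching presented by the endpoint functions `u`, `v`. -/
def omEdges {s : ℕ} (u v : Fin s → V) : Set (Sym2 V) := {e | ∃ i, e = s(u i, v i)}

/-- `(u, v)` describes a matching of size `s` in `G`: the `2s` endpoints are pairwise
distinct (so the edges are pairwise disjoint) and each pair `{u i, v i}` is an edge. -/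
def IsMatchingPair (G : SimpleGraph V) {s : ℕ} (u v : Fin s → V) : Prop :=
  Function.Injective (Sum.elim u v) ∧ ∀ i, G.Adj (u i) (v i)

/-- `(u, v)` describes an ordered matching: a matching such that `{u 1, …, u s}` is an
independent set and `{u i, v j} ∈ E(G)` implies `i ≤ j`. -/
def IsOrderedMatching (G : SimpleGraph V) {s : ℕ} (u v : Fin s → V) : Prop :=
  IsMatchingPair G u v ∧ (∀ i j, ¬ G.Adj (u i) (u j)) ∧
    ∀ i j, G.Adj (u i) (v j) → i ≤ j

/-- The matching number of `G`. -/
noncomputable def nu (G : SimpleGraph V) : ℕ :=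
  sSup {s | ∃ u v : Fin s → V, IsMatchingPair G u v}

/-- The ordered matching number of `G`. -/
noncomputable def nu0 (G : SimpleGraph V) : ℕ :=
  sSup {s | ∃ u v : Fin s → V, IsOrderedMatching G u v}

/-- A walk is `M`-alternating if its edges are alternately in `M` and not in `M`. -/
def IsAlt {G : SimpleGraph V} (M : Set (Sym2 V)) {a b : V} (w : G.Walk a b) : Prop :=
  List.Chain' (fun e f => (e ∈ M ↔ f ∉ M)) w.edges

/-- The walk `w` is nonempty and its first and last edges belong to `M`. -/
def FirstLastInM {G : SimpleGraph V} (M : Set (Sym2 V)) {a b : V} (w : G.Walk a b) : Prop :=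
  ∃ h : w.edges ≠ [], w.edges.head h ∈ M ∧ w.edges.getLast h ∈ M

/-- `w` is an `M`-admissible path for the vertex `x` (with respect to the ordered matching
presented by `(u, v)`): an `M`-alternating path with origin `x` whose first and last
edges are in `M`, each of whose edges has an end in `A = range u` and an end in
`B = range v`. -/
def IsAdmissible {G : SimpleGraph V} {s : ℕ} (u v : Fin s → V) {a b : V}
    (w : G.Walk a b) (x : V) : Prop :=
  a = x ∧ IsAlt (omEdges u v) w ∧ FirstLastInM (omEdges u v) w ∧
    ∀ e ∈ w.edges, ∃ i j, e = s(u i, v j)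

/-- `ℓ(x)`: the length of a longest `M`-admissible path for `x`. -/
noncomputable def ellv (G : SimpleGraph V) {s : ℕ} (u v : Fin s → V) (x : V) : ℕ :=
  sSup {n | ∃ (b : V) (w : G.Walk x b), IsAdmissible u v w x ∧ w.length = n}

/-- `ℓ(M)`: the length of a longest `M`-alternating path in `G`. -/
noncomputable def ellM (G : SimpleGraph V) (M : Set (Sym2 V)) : ℕ :=
  sSup {n | ∃ (a b : V) (w : G.Walk a b), IsAlt M w ∧ w.length = n}

/-- `ℓ₀(M) = max {ℓ(x) : x ∈ B}`. -/
noncomputable def ell0 (G : SimpleGraph V) {s : ℕ} (u v : Fin s → V) : ℕ :=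
  sSup {n | ∃ i : Fin s, ellv G u v (v i) = n}

/-- `ℓ₁(M) = max {ℓ(x) + ℓ(y) + 1 : {x, y} ∈ E(G[B])}` (with the convention that this
is `0` when `B` is independent, since `sSup ∅ = 0`). -/
noncomputable def ell1 (G : SimpleGraph V) {s : ℕ} (u v : Fin s → V) : ℕ :=
  sSup {n | ∃ i j : Fin s, G.Adj (v i) (v j) ∧ ellv G u v (v i) + ellv G u v (v j) + 1 = n}

/-- `ℓ(G) = min {ℓ(M) : M a maximum ordered matching of G}`. -/
noncomputable def ellG (G : SimpleGraph V) : ℕ :=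
  sInf {n | ∃ u v : Fin (nu0 G) → V, IsOrderedMatching G u v ∧ ellM G (omEdges u v) = n}

open MvPolynomial in
/-- The `n`-th symbolic power `J(G)^{(n)} = ⋂_{{u,v} ∈ E(G)} (x_u, x_v)^n` of the cover
ideal of `G`. -/
noncomputable def symbPow (K : Type*) [Field K] (G : SimpleGraph V) (n : ℕ) :
    Ideal (MvPolynomial V K) :=
  ⨅ (p : V × V) (_ : G.Adj p.1 p.2), (Ideal.span {X p.1, X p.2}) ^ n

/-- The cover ideal `J(G) = ⋂_{{u,v} ∈ E(G)} (x_u, x_v)`. -/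
noncomputable def coverIdeal (K : Type*) [Field K] (G : SimpleGraph V) :
    Ideal (MvPolynomial V K) :=
  symbPow K G 1

/-- `depth R/I`: the length of a maximal `R/I`-regular sequence contained in the maximal
homogeneous ideal `(x_1, …, x_r)` of `R = K[x_1, …, x_r]`. -/
noncomputable def depthQ (K : Type*) [Field K] (I : Ideal (MvPolynomial V K)) : ℕ :=
  sSup {n | ∃ rs : List (MvPolynomial V K), rs.length = n ∧
    (∀ f ∈ rs, f ∈ Ideal.span (Set.range (MvPolynomial.X : V → MvPolynomial V K))) ∧
    RingTheory.Sequence.IsRegular (MvPolynomial V K ⧸ I) rs}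

/-- The stability index of the symbolic depth function of `J(G)`:
`sdst(J(G)) = min {n₀ ≥ 1 : depth R/J(G)^{(n)} = r − ν₀(G) − 1 for all n ≥ n₀}`. -/
noncomputable def sdst (K : Type*) [Field K] [Fintype V] (G : SimpleGraph V) : ℕ :=
  sInf {n0 | 1 ≤ n0 ∧ ∀ n, n0 ≤ n →
    depthQ K (symbPow K G n) = Fintype.card V - nu0 G - 1}

/-- The stability index of the depth function of `J(G)`:
the least `n₀ ≥ 1` such that `depth R/J(G)^n` is constant for `n ≥ n₀` (hence equal to
its limit value). -/
noncomputable def dst (K : Type*) [Field K] [Fintype V] (G : SimpleGraph V) : ℕ :=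
  sInf {n0 | 1 ≤ n0 ∧ ∀ m n, n0 ≤ m → n0 ≤ n →
    depthQ K (coverIdeal K G ^ m) = depthQ K (coverIdeal K G ^ n)}

end DS

namespace DS

section Koszul

variable {V R M N : Type*} [CommRing R] [AddCommGroup M] [Module R M]
  [AddCommGroup N] [Module R N]

/-- `g` is concentrated in homological degree `i`. -/
def IsHomog (i : ℕ) (g : Finset V → M) : Prop := ∀ τ, τ.card ≠ i → g τ = 0

lemma IsHomog.add {i : ℕ} {g h : Finset V → M} (hg : IsHomog i g) (hh : IsHomog i h) :
    IsHomog i (g + h) := fun τ hτ => by simp [hg τ hτ, hh τ hτ]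

lemma IsHomog.sub {i : ℕ} {g h : Finset V → M} (hg : IsHomog i g) (hh : IsHomog i h) :
    IsHomog i (g - h) := fun τ hτ => by simp [hg τ hτ, hh τ hτ]

lemma IsHomog.smul {i : ℕ} {g : Finset V → M} (hg : IsHomog i g) (a : R) :
    IsHomog i (a • g) := fun τ hτ => by simp [hg τ hτ]

lemma IsHomog.sum {ι : Type*} {s : Finset ι} {i : ℕ} {g : ι → Finset V → M}
    (hg : ∀ k ∈ s, IsHomog i (g k)) : IsHomog i (∑ k ∈ s, g k) := fun τ hτ => by
  rw [Finset.sum_apply]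
  exact Finset.sum_eq_zero fun k hk => hg k hk τ hτ

lemma IsHomog.exists_lift (P : Submodule R M) {i : ℕ} {g : Finset V → M ⧸ P} (hg : IsHomog i g) :
    ∃ z : Finset V → M, IsHomog i z ∧ g = fun τ => P.mkQ (z τ) := by
  classical
  choose z hz using fun τ => P.mkQ_surjective (g τ)
  refine ⟨fun τ => if τ.card = i then z τ else 0, fun τ hτ => by simp [hτ], ?_⟩
  ext τ
  by_cases h : τ.card = i
  · simp only [if_pos h, hz]
  · simp only [if_neg h, map_zero, hg τ h]

open scoped Pointwise in
lemma mkQ_smul_top_eq_zero_iff {f : R} {m : M} :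
    (f • (⊤ : Submodule R M)).mkQ m = 0 ↔ ∃ m', f • m' = m := by
  rw [Submodule.mkQ_apply, Submodule.Quotient.mk_eq_zero,
    Submodule.mem_smul_pointwise_iff_exists]
  simp

variable [LinearOrder V]

/-- The sign of inserting `v` into the finite set `τ`. -/
def insertSign (v : V) (τ : Finset V) : ℤ := (-1) ^ (τ.filter (· < v)).card

lemma insertSign_insert (v : V) {w : V} {τ : Finset V} (hw : w ∉ τ) :
    insertSign v (insert w τ) = if w < v then -insertSign v τ else insertSign v τ := by
  unfold insertSign
  rw [Finset.filter_insert]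
  split_ifs with h
  · rw [Finset.card_insert_of_notMem (by simp [hw]), pow_succ]; ring
  · rfl

lemma insertSign_mul_self (v : V) (τ : Finset V) : insertSign v τ * insertSign v τ = 1 := by
  unfold insertSign
  rw [← mul_pow]; simp

lemma insertSign_erase (v : V) {w : V} {τ : Finset V} (hw : w ∈ τ) :
    insertSign v (τ.erase w) = if w < v then -insertSign v τ else insertSign v τ := by
  have h := insertSign_insert v (Finset.notMem_erase w τ)
  rw [Finset.insert_erase hw] at h
  rw [h]; split_ifs <;> simp

variable (R M) in
/-- Contraction by the basis vector `v` on the cochains `Finset V → M`. -/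
def contract (v : V) : Module.End R (Finset V → M) where
  toFun g τ := if v ∈ τ then 0 else insertSign v τ • g (insert v τ)
  map_add' g h := by ext τ; by_cases hv : v ∈ τ <;> simp [hv]
  map_smul' a g := by ext τ; by_cases hv : v ∈ τ <;> simp [hv, smul_comm a]

variable (R M) in
/-- Exterior multiplication by the basis vector `v` on the cochains `Finset V → M`. -/
def wedge (v : V) : Module.End R (Finset V → M) where
  toFun g τ := if v ∈ τ then insertSign v τ • g (τ.erase v) else 0
  map_add' g h := by ext τ; by_cases hv : v ∈ τ <;> simp [hv]
  map_smul' a g := by ext τ; by_cases hv : v ∈ τ <;> simp [hv, smul_comm a]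

lemma contract_apply (v : V) (g : Finset V → M) (τ : Finset V) :
    contract R M v g τ = if v ∈ τ then 0 else insertSign v τ • g (insert v τ) := rfl

lemma wedge_apply (v : V) (g : Finset V → M) (τ : Finset V) :
    wedge R M v g τ = if v ∈ τ then insertSign v τ • g (τ.erase v) else 0 := rfl

lemma contract_wedge_self (v : V) (g : Finset V → M) :
    contract R M v (wedge R M v g) = g - wedge R M v (contract R M v g) := by
  ext τ
  by_cases hv : v ∈ τ
  · have h := insertSign_erase v hv
    simp only [lt_irrefl, if_false] at h
    simp [contract_apply, wedge_apply, hv, smul_smul, h, insertSign_mul_self]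
  · have h := insertSign_insert v hv
    simp only [lt_irrefl, if_false] at h
    simp [contract_apply, wedge_apply, hv, smul_smul, h, insertSign_mul_self]

lemma contract_wedge_of_ne {v w : V} (hvw : v ≠ w) (g : Finset V → M) :
    contract R M v (wedge R M w g) = -wedge R M w (contract R M v g) := by
  ext τ
  by_cases hv : v ∈ τ
  · simp [contract_apply, wedge_apply, hv, hvw]
  · by_cases hw : w ∈ τ
    · have h1 := insertSign_insert w hv
      have h2 := insertSign_erase v hw
      have h3 : (insert v τ).erase w = insert v (τ.erase w) :=
        Finset.erase_insert_of_ne hvw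
      simp only [contract_apply, wedge_apply, hv, hw, Finset.mem_insert, Finset.mem_erase,
        Pi.neg_apply, if_true, if_false, or_true, and_false, smul_smul, h1, h2, h3]
      rcases lt_or_gt_of_ne hvw with h | h
      · simp [h, h.not_gt, mul_comm]
      · simp [h, h.not_gt, mul_comm]
    · simp [contract_apply, wedge_apply, hv, hw, hvw.symm]

lemma contract_contract_self (v : V) (g : Finset V → M) :
    contract R M v (contract R M v g) = 0 := by
  ext τ
  simp [contract_apply]

lemma contract_contract_anticomm {v w : V} (hvw : v ≠ w) (g : Finset V → M) :
    contract R M v (contract R M w g) = -contract R M w (contract R M v g) := by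
  ext τ
  by_cases hv : v ∈ τ
  · simp [contract_apply, hv]
  · by_cases hw : w ∈ τ
    · simp [contract_apply, hw]
    · have h1 := insertSign_insert w hv
      have h2 := insertSign_insert v hw
      simp only [contract_apply, hv, hw, hvw, hvw.symm, Finset.mem_insert, Pi.neg_apply, or_false,
        if_false, smul_smul, h1, h2, Finset.insert_comm v w]
      rcases lt_or_gt_of_ne hvw with h | h
      · simp [h, h.not_gt, mul_comm]
      · simp [h, h.not_gt, mul_comm]

lemma IsHomog.contract {i : ℕ} {g : Finset V → M} (hg : IsHomog (i + 1) g) (v : V) :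
    IsHomog i (contract R M v g) := by
  intro τ hτ
  by_cases hv : v ∈ τ
  · simp [contract_apply, hv]
  · rw [contract_apply, if_neg hv, hg, smul_zero]
    rw [Finset.card_insert_of_notMem hv]; omega

lemma IsHomog.wedge {i : ℕ} {g : Finset V → M} (hg : IsHomog i g) (v : V) :
    IsHomog (i + 1) (wedge R M v g) := by
  intro τ hτ
  by_cases hv : v ∈ τ
  · rw [wedge_apply, if_pos hv, hg, smul_zero]
    rw [Finset.card_erase_of_mem hv]
    have := Finset.card_pos.2 ⟨v, hv⟩
    omega
  · simp [wedge_apply, hv]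

variable [Fintype V]

/-- The Koszul differential of the family `x` with coefficients in `M`. -/
def koszulD (M : Type*) [AddCommGroup M] [Module R M] (x : V → R) :
    Module.End R (Finset V → M) :=
  ∑ v, x v • contract R M v

lemma koszulD_eq (x : V → R) (g : Finset V → M) :
    koszulD M x g = ∑ v, x v • contract R M v g := by
  simp [koszulD]

lemma koszulD_apply (x : V → R) (g : Finset V → M) (τ : Finset V) :
    koszulD M x g τ = ∑ v, x v • contract R M v g τ := by
  simp [koszulD]

lemma contract_koszulD (x : V → R) (v : V) (g : Finset V → M) :
    contract R M v (koszulD M x g) = -koszulD M x (contract R M v g) := by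
  rw [koszulD_eq, koszulD_eq, map_sum, ← Finset.sum_neg_distrib]
  refine Finset.sum_congr rfl fun w _ => ?_
  rw [map_smul]
  by_cases h : v = w
  · subst h; simp [contract_contract_self]
  · rw [contract_contract_anticomm h, smul_neg]

lemma koszulD_koszulD (x : V → R) (g : Finset V → M) :
    koszulD M x (koszulD M x g) = 0 := by
  rw [koszulD_eq, koszulD_eq]
  simp only [map_sum, map_smul, Finset.smul_sum]
  rw [← Finset.sum_product']
  refine Finset.sum_involution (fun p _ => (p.2, p.1)) ?_ ?_ (by simp) (by simp)
  · rintro ⟨v, w⟩ -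
    by_cases h : v = w
    · subst h; simp [contract_contract_self]
    · simp only [contract_contract_anticomm h, smul_neg, smul_comm (x w) (x v)]
      simp
  · rintro ⟨v, w⟩ - h0 h
    simp only [Prod.mk.injEq] at h
    obtain ⟨rfl, -⟩ := h
    simp [contract_contract_self] at h0

lemma koszulD_wedge (x : V → R) (w : V) (g : Finset V → M) :
    koszulD M x (wedge R M w g) = x w • g - wedge R M w (koszulD M x g) := by
  rw [koszulD_eq, koszulD_eq, map_sum, ← Finset.add_sum_erase _ _ (Finset.mem_univ w),
    ← Finset.add_sum_erase (a := w) (f := fun i => wedge R M w (x i • contract R M i g)) _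
      (Finset.mem_univ w), contract_wedge_self,
    Finset.sum_congr rfl fun v hv => by
      rw [contract_wedge_of_ne (Finset.ne_of_mem_erase hv), smul_neg, ← map_smul]]
  rw [Finset.sum_neg_distrib, smul_sub, map_smul]
  abel

/-- A map of coefficients commutes with the Koszul differential. -/
lemma koszulD_comp (x : V → R) (f : M →ₗ[R] N) (g : Finset V → M) :
    koszulD N x (fun τ => f (g τ)) = fun τ => f (koszulD M x g τ) := by
  ext τ
  rw [koszulD_apply, koszulD_apply, map_sum]
  refine Finset.sum_congr rfl fun v _ => ?_
  by_cases hv : v ∈ τ <;> simp [contract_apply, hv]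

lemma IsHomog.koszulD {i : ℕ} {g : Finset V → M} (hg : IsHomog (i + 1) g) (x : V → R) :
    IsHomog i (koszulD M x g) := by
  rw [koszulD_eq]
  exact IsHomog.sum fun v _ => (hg.contract v).smul _

/-- Exactness in degree `i` of the subcomplex of the Koszul complex cut out by `D`. -/
def KoszulExact (x : V → R) (D : Finset V → Set M) (i : ℕ) : Prop :=
  ∀ g : Finset V → M, IsHomog i g → (∀ τ, g τ ∈ D τ) → koszulD M x g = 0 →
    ∃ h : Finset V → M, IsHomog (i + 1) h ∧ (∀ τ, h τ ∈ D τ) ∧ koszulD M x h = g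

/-- A weakly regular sequence in the ideal generated by `x` forces vanishing of
Koszul homology in high degrees. -/
theorem koszulExact_of_isWeaklyRegular (x : V → R) :
    ∀ (rs : List R) (M : Type*) [AddCommGroup M] [Module R M],
      RingTheory.Sequence.IsWeaklyRegular M rs → (∀ f ∈ rs, f ∈ Ideal.span (Set.range x)) →
      ∀ i, Fintype.card V < i + rs.length → KoszulExact x (fun _ => (Set.univ : Set M)) i
  | [], M, _, _, _, _, i, hi => by
    intro g hg _ _
    refine ⟨0, fun _ _ => rfl, by simp, ?_⟩
    rw [map_zero]
    ext τ
    have := Finset.card_le_univ τ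
    exact (hg τ (by simp at hi; omega)).symm
  | f :: rs, M, _, _, hreg, hmem, i, hi => by
    rw [RingTheory.Sequence.isWeaklyRegular_cons_iff] at hreg
    have ih := koszulExact_of_isWeaklyRegular x rs (QuotSMulTop f M) hreg.2
      (fun a ha => hmem a (List.mem_cons_of_mem _ ha)) (i + 1) (by simp at hi; omega)
    intro z hz _ hdz
    obtain ⟨a, ha⟩ := Ideal.mem_span_range_iff_exists_fun.1 (hmem f List.mem_cons_self)
    set w : Finset V → M := ∑ v, a v • wedge R M v z with hw
    have hdw : koszulD M x w = f • z := by
      rw [hw, map_sum, ← ha, Finset.sum_smul]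
      refine Finset.sum_congr rfl fun v _ => ?_
      rw [map_smul, koszulD_wedge, hdz, map_zero, sub_zero, smul_smul]
    have hwh : IsHomog (i + 1) w := IsHomog.sum fun v _ => (hz.wedge v).smul _
    let π : M →ₗ[R] QuotSMulTop f M := Submodule.mkQ _
    have hπ : ∀ m : M, π m = 0 ↔ ∃ m', f • m' = m := fun m => mkQ_smul_top_eq_zero_iff
    obtain ⟨y, hy, -, hdy⟩ := ih (fun τ => π (w τ)) (fun τ hτ => by simp [hwh τ hτ])
      (by simp) (by
        rw [koszulD_comp, hdw]
        ext τ
        exact (hπ _).2 ⟨z τ, rfl⟩)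
    obtain ⟨y'', hy''h, hy''⟩ := hy.exists_lift
    have hdiff : ∀ τ, ∃ m, f • m = (w - koszulD M x y'') τ := by
      intro τ
      rw [← hπ]
      rw [hy'', koszulD_comp x π] at hdy
      have := congrFun hdy τ
      simp [this]
    choose q hq using hdiff
    have hq' : f • q = w - koszulD M x y'' := funext hq
    refine ⟨q, ?_, by simp, ?_⟩
    · intro τ hτ
      apply hreg.1
      simp only [hq, smul_zero]
      exact (hwh.sub (hy''h.koszulD x)) τ hτ
    · ext τ
      apply hreg.1
      have : f • koszulD M x q = f • z := by
        rw [← map_smul, hq', map_sub, koszulD_koszulD, sub_zero, hdw]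
      exact congrFun this τ

/-- Vanishing of Koszul homology in high degrees passes to the quotient by a regular element. -/
lemma KoszulExact.quotSMulTop {x : V → R} {f : R} {i : ℕ} (hf : IsSMulRegular M f)
    (h0 : KoszulExact x (fun _ => (Set.univ : Set M)) i)
    (h1 : KoszulExact x (fun _ => (Set.univ : Set M)) (i + 1)) :
    KoszulExact x (fun _ => (Set.univ : Set (QuotSMulTop f M))) (i + 1) := by
  let π : M →ₗ[R] QuotSMulTop f M := Submodule.mkQ _
  have hπ : ∀ m : M, π m = 0 ↔ ∃ m', f • m' = m := fun m => mkQ_smul_top_eq_zero_iff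
  intro g hg _ hdg
  obtain ⟨z, hzh, hzg⟩ := hg.exists_lift
  rw [hzg, koszulD_comp x π] at hdg
  choose w hw using fun τ => (hπ (koszulD M x z τ)).1 (congrFun hdg τ)
  have hw' : f • w = koszulD M x z := funext hw
  obtain ⟨y, hy, -, hdy⟩ := h0 w (fun τ hτ => hf (by
      simp only [hw, smul_zero]; exact hzh.koszulD x τ hτ)) (by simp) (by
      ext τ
      apply hf
      have : f • koszulD M x w = 0 := by rw [← map_smul, hw', koszulD_koszulD]
      simpa using congrFun this τ)
  obtain ⟨q, hq, -, hdq⟩ := h1 (z - f • y) (hzh.sub (hy.smul f)) (by simp) (by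
    rw [map_sub, map_smul, hdy, hw', sub_self])
  refine ⟨fun τ => π (q τ), fun τ hτ => by simp [hq τ hτ], by simp, ?_⟩
  rw [koszulD_comp, hdq, hzg]
  ext τ
  have : π (f • y τ) = 0 := (hπ _).2 ⟨_, rfl⟩
  simp only [Pi.sub_apply, Pi.smul_apply, map_sub, this, sub_zero]
  rfl

lemma exists_isSMulRegular [IsNoetherianRing R] [Module.Finite R M] {x : V → R}
    (h : KoszulExact x (fun _ => (Set.univ : Set M)) (Fintype.card V)) :
    ∃ f ∈ Ideal.span (Set.range x), IsSMulRegular M f := by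
  by_contra! hcon
  have hsub : ((Ideal.span (Set.range x) : Ideal R) : Set R) ⊆
      ⋃ p ∈ associatedPrimes R M, (p : Set R) := by
    rw [biUnion_associatedPrimes_eq_compl_regular]
    exact fun f hf => hcon f hf
  rw [Ideal.subset_union_prime_finite (associatedPrimes.finite R M) ⊥ ⊥
    (fun p hp _ _ => hp.isPrime)] at hsub
  obtain ⟨p, hp, hle⟩ := hsub
  obtain ⟨hprime, a, rfl⟩ := isAssociatedPrime_iff.1 hp
  have hxa : ∀ v, x v • a = 0 := fun v => by
    have := hle (Ideal.subset_span (Set.mem_range_self v))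
    simpa [Submodule.mem_colon_singleton] using this
  obtain ⟨q, hq, -, hdq⟩ := h (fun τ => if τ = Finset.univ then a else 0)
    (fun τ hτ => if_neg fun h => hτ (by rw [h, Finset.card_univ])) (by simp) (by
      ext τ
      rw [koszulD_apply]
      refine Finset.sum_eq_zero fun v _ => ?_
      rw [contract_apply]
      split_ifs <;> simp [smul_comm (x v), hxa])
  have hq0 : q = 0 := by
    ext τ
    have := Finset.card_le_univ τ
    exact hq τ (by omega)
  have ha0 : a = 0 := by
    have := congrFun hdq Finset.univ
    rw [hq0, map_zero] at this
    simpa using this.symm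
  refine hprime.ne_top ?_
  rw [Ideal.eq_top_iff_one, Submodule.mem_colon_singleton, ha0]
  simp

/-- Vanishing of Koszul homology in high degrees yields long weakly regular sequences. -/
theorem exists_isWeaklyRegular [IsNoetherianRing R] (x : V → R) :
    ∀ (t : ℕ) (M : Type*) [AddCommGroup M] [Module R M] [Module.Finite R M],
      t ≤ Fintype.card V →
      (∀ i, Fintype.card V < i + t → KoszulExact x (fun _ => (Set.univ : Set M)) i) →
      ∃ rs : List R, rs.length = t ∧ (∀ f ∈ rs, f ∈ Ideal.span (Set.range x)) ∧
        RingTheory.Sequence.IsWeaklyRegular M rs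
  | 0, M, _, _, _, _, _ => ⟨[], rfl, by simp, RingTheory.Sequence.IsWeaklyRegular.nil R M⟩
  | t + 1, M, _, _, _, ht, h => by
    obtain ⟨f, hf, hreg⟩ := exists_isSMulRegular (h (Fintype.card V) (by omega))
    obtain ⟨rs, hlen, hmem, hrs⟩ := exists_isWeaklyRegular x t (QuotSMulTop f M) (by omega) (by
      rintro (_ | i) hi
      · omega
      · exact (h i (by omega)).quotSMulTop hreg (h (i + 1) (by omega)))
    exact ⟨f :: rs, by simp [hlen], by simpa using ⟨hf, hmem⟩, hrs.cons hreg⟩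

end Koszul
end DS

namespace DS

section Quotient

variable {V R : Type*} [CommRing R] [LinearOrder V] [Fintype V]

/-- Koszul homology of `R ⧸ I` and of `I` agree up to a shift, as long as that of `R` vanishes. -/
theorem koszulExact_quotient_iff {x : V → R} {I : Ideal R} {i : ℕ}
    (h0 : KoszulExact x (fun _ => (Set.univ : Set R)) i)
    (h1 : KoszulExact x (fun _ => (Set.univ : Set R)) (i + 1)) :
    KoszulExact x (fun _ => (Set.univ : Set (R ⧸ I))) (i + 1) ↔
      KoszulExact x (fun _ => (I : Set R)) i := by
  have hπ : ∀ a : R, I.mkQ a = 0 ↔ a ∈ I := fun a => by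
    rw [Submodule.mkQ_apply, Submodule.Quotient.mk_eq_zero]
  constructor
  · intro h z hz hzI hdz
    obtain ⟨w, hw, -, hdw⟩ := h0 z hz (by simp) hdz
    obtain ⟨y, hy, -, hdy⟩ := h (fun τ => I.mkQ (w τ)) (fun τ hτ => by simp only [hw τ hτ, map_zero])
      (by simp) (by
        rw [koszulD_comp, hdw]
        ext τ
        exact (hπ _).2 (hzI τ))
    obtain ⟨y', hy', rfl⟩ := hy.exists_lift
    rw [koszulD_comp] at hdy
    refine ⟨w - koszulD R x y', hw.sub (hy'.koszulD x), fun τ => (hπ _).1 ?_, ?_⟩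
    · rw [Pi.sub_apply, map_sub, congrFun hdy τ, sub_self]
    · rw [map_sub, koszulD_koszulD, sub_zero, hdw]
  · intro h g hg _ hdg
    obtain ⟨z, hz, rfl⟩ := hg.exists_lift
    rw [koszulD_comp] at hdg
    obtain ⟨y, hy, hyI, hdy⟩ := h (koszulD R x z) (hz.koszulD x)
      (fun τ => (hπ _).1 (congrFun hdg τ)) (koszulD_koszulD x z)
    obtain ⟨q, hq, -, hdq⟩ := h1 (z - y) (hz.sub hy) (by simp) (by rw [map_sub, hdy, sub_self])
    refine ⟨fun τ => I.mkQ (q τ), fun τ hτ => by simp only [hq τ hτ, map_zero], by simp, ?_⟩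
    rw [koszulD_comp, hdq]
    ext τ
    rw [Pi.sub_apply, map_sub, (hπ (y τ)).2 (hyI τ), sub_zero]

lemma mk_one_notMem_smul_top {I J : Ideal R} (hIJ : I ≤ J) (hJ : (1 : R) ∉ J) :
    I.mkQ 1 ∉ J • (⊤ : Submodule R (R ⧸ I)) := by
  intro h
  have hle : J • (⊤ : Submodule R (R ⧸ I)) ≤ Submodule.map I.mkQ J := by
    rw [Submodule.smul_le]
    rintro a ha y -
    obtain ⟨b, rfl⟩ := I.mkQ_surjective y
    exact ⟨a • b, J.mul_mem_right b ha, map_smul _ _ _⟩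
  obtain ⟨a, ha, ha'⟩ := hle h
  have : I.mkQ (1 - a) = 0 := by rw [map_sub, ha', sub_self]
  rw [Submodule.mkQ_apply, Submodule.Quotient.mk_eq_zero] at this
  exact hJ (by simpa using J.add_mem (hIJ this) ha)

lemma mk_one_mem_of_koszulExact_zero {x : V → R} {I : Ideal R}
    (h : KoszulExact x (fun _ => (Set.univ : Set (R ⧸ I))) 0) :
    I.mkQ 1 ∈ Ideal.span (Set.range x) • (⊤ : Submodule R (R ⧸ I)) := by
  obtain ⟨q, -, -, hdq⟩ := h (fun τ => if τ = ∅ then I.mkQ 1 else 0)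
    (fun τ hτ => if_neg fun h => hτ (by simp [h])) (by simp) (by
      ext τ
      rw [koszulD_apply]
      refine Finset.sum_eq_zero fun v _ => ?_
      rw [contract_apply]
      split_ifs <;> simp_all)
  have := congrFun hdq ∅
  rw [koszulD_apply] at this
  simp only [if_true] at this
  rw [← this]
  exact sum_mem fun v _ =>
    Submodule.smul_mem_smul (Ideal.subset_span (Set.mem_range_self v)) trivial

end Quotient

section Graded

open MvPolynomial

variable {V K : Type*} [Field K]

lemma coeff_zsmul (m : V →₀ ℕ) (n : ℤ) (f : MvPolynomial V K) :
    coeff m (n • f) = n • coeff m f := map_zsmul (coeffAddMonoidHom m) n f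

/-- The exponent vector of the squarefree monomial with support `τ`. -/
noncomputable def sqfree (τ : Finset V) : V →₀ ℕ := Finsupp.indicator τ fun _ _ => 1

/-- The component of multidegree `b` of a Koszul chain over the polynomial ring. -/
noncomputable def gradedPart (b : V →₀ ℕ) (g : Finset V → MvPolynomial V K) (τ : Finset V) : K :=
  if sqfree τ ≤ b then coeff (b - sqfree τ) (g τ) else 0

/-- The Koszul chain of multidegree `b` with prescribed coefficients. -/
noncomputable def ofGradedPart (b : V →₀ ℕ) (c : Finset V → K) (τ : Finset V) :
    MvPolynomial V K :=
  if sqfree τ ≤ b then monomial (b - sqfree τ) (c τ) else 0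

lemma gradedPart_ext {g h : Finset V → MvPolynomial V K}
    (H : ∀ b, gradedPart b g = gradedPart b h) : g = h := by
  ext τ m
  have := congrFun (H (m + sqfree τ)) τ
  simpa [gradedPart] using this

lemma gradedPart_sum {ι : Type*} (s : Finset ι) (b : V →₀ ℕ)
    (g : ι → Finset V → MvPolynomial V K) :
    gradedPart b (∑ k ∈ s, g k) = ∑ k ∈ s, gradedPart b (g k) := by
  ext τ
  by_cases h : sqfree τ ≤ b <;> simp [gradedPart, h, coeff_sum]

lemma gradedPart_zero (b : V →₀ ℕ) :
    gradedPart b (0 : Finset V → MvPolynomial V K) = 0 := by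
  ext τ
  simp [gradedPart]

/-- The faces of the upper Koszul complex in multidegree `b` of a set of monomials `P`. -/
def upperKoszul (P : (V →₀ ℕ) → Prop) (b : V →₀ ℕ) (τ : Finset V) : Prop :=
  sqfree τ ≤ b ∧ P (b - sqfree τ)

variable [LinearOrder V]

lemma sqfree_apply (τ : Finset V) (v : V) : sqfree τ v = if v ∈ τ then 1 else 0 := by
  simp [sqfree, Finsupp.indicator_apply]

lemma sqfree_insert {v : V} {τ : Finset V} (hv : v ∉ τ) :
    sqfree (insert v τ) = sqfree τ + Finsupp.single v 1 := by
  ext w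
  simp only [sqfree_apply, Finsupp.add_apply, Finsupp.single_apply, Finset.mem_insert]
  by_cases h : w = v
  · subst h; simp [hv]
  · simp [h, Ne.symm h]

lemma gradedPart_ofGradedPart {b b' : V →₀ ℕ} {c : Finset V → K}
    (hc : ∀ τ, c τ ≠ 0 → sqfree τ ≤ b) :
    gradedPart b' (ofGradedPart b c) = if b = b' then c else 0 := by
  ext τ
  by_cases h : b = b'
  · subst h
    by_cases hb : sqfree τ ≤ b
    · simp [gradedPart, ofGradedPart, hb]
    · have : c τ = 0 := by by_contra h; exact hb (hc τ h)
      simp [gradedPart, hb, this]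
  · by_cases hb : sqfree τ ≤ b
    · by_cases hb' : sqfree τ ≤ b'
      · have : b - sqfree τ ≠ b' - sqfree τ := fun h' => h (by
          rw [← tsub_add_cancel_of_le hb, h', tsub_add_cancel_of_le hb'])
        simp [gradedPart, ofGradedPart, hb, hb', h, coeff_monomial, this]
      · simp [gradedPart, hb', h]
    · simp [gradedPart, ofGradedPart, hb, h]

variable [Fintype V]

/-- Vanishing in degree `i` of the homology over `K` of the simplicial complex `Δ`, where
a face with `i` vertices has degree `i`. -/
def FaceExact (K : Type*) [Field K] (Δ : Finset V → Prop) (i : ℕ) : Prop :=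
  KoszulExact (fun _ : V => (1 : K)) (fun τ => {a : K | a ≠ 0 → Δ τ}) i

lemma gradedPart_koszulD (b : V →₀ ℕ) (g : Finset V → MvPolynomial V K) :
    gradedPart b (koszulD (MvPolynomial V K) (X : V → MvPolynomial V K) g) =
      koszulD K (fun _ => (1 : K)) (gradedPart b g) := by
  ext τ
  rw [koszulD_apply, gradedPart, koszulD_apply]
  by_cases hb : sqfree τ ≤ b
  · rw [if_pos hb, coeff_sum]
    refine Finset.sum_congr rfl fun v _ => ?_
    rw [contract_apply, contract_apply, gradedPart]
    by_cases hv : v ∈ τ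
    · simp [hv]
    · have hiff : sqfree (insert v τ) ≤ b ↔ v ∈ (b - sqfree τ).support := by
        rw [sqfree_insert hv, Finsupp.mem_support_iff, Finsupp.tsub_apply, sqfree_apply,
          if_neg hv, Nat.sub_zero]
        constructor
        · intro h
          have := h v
          simp [sqfree_apply, hv] at this
          omega
        · intro h w
          have := hb w
          by_cases hw : v = w
          · subst hw; simp [sqfree_apply, hv]; omega
          · simpa [Finsupp.single_apply, hw] using this
      rw [if_neg hv, if_neg hv, smul_comm, smul_comm (1 : K), smul_eq_mul, one_smul,
        coeff_zsmul, coeff_X_mul']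
      simp only [← hiff]
      rw [sqfree_insert hv, tsub_add_eq_tsub_tsub]
  · rw [if_neg hb]
    refine (Finset.sum_eq_zero fun v _ => ?_).symm
    rw [contract_apply, gradedPart]
    by_cases hv : v ∈ τ
    · simp [hv]
    · rw [if_neg hv, if_neg, smul_zero, smul_zero]
      rw [sqfree_insert hv]
      exact fun h => hb (le_self_add.trans h)

/-- Multigraded decomposition of the Koszul homology of a monomial ideal. -/
theorem koszulExact_monomialIdeal_iff {P : (V →₀ ℕ) → Prop} {I : Ideal (MvPolynomial V K)}
    (hI : ∀ f, f ∈ I ↔ ∀ m ∈ f.support, P m) (i : ℕ) :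
    KoszulExact (X : V → MvPolynomial V K) (fun _ => (I : Set (MvPolynomial V K))) i ↔
      ∀ b, FaceExact K (upperKoszul P b) i := by
  have hmem : ∀ b (c : Finset V → K), (∀ τ, c τ ≠ 0 → upperKoszul P b τ) →
      ∀ τ, ofGradedPart b c τ ∈ I := by
    intro b c hc τ
    rw [ofGradedPart]
    split_ifs with h
    · rw [hI]
      intro m hm
      rw [mem_support_iff, coeff_monomial] at hm
      simp only [ne_eq, ite_eq_right_iff, not_forall] at hm
      obtain ⟨rfl, hm⟩ := hm
      exact (hc τ hm).2
    · exact I.zero_mem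
  have hmem' : ∀ b (g : Finset V → MvPolynomial V K), (∀ τ, g τ ∈ I) →
      ∀ τ, gradedPart b g τ ≠ 0 → upperKoszul P b τ := by
    intro b g hg τ hτ
    rw [gradedPart] at hτ
    split_ifs at hτ with h
    · exact ⟨h, (hI _).1 (hg τ) _ (mem_support_iff.2 hτ)⟩
    · exact absurd rfl hτ
  have hhom : ∀ b (c : Finset V → K) j, IsHomog j c → IsHomog j (ofGradedPart b c) := by
    intro b c j hc τ hτ
    simp [ofGradedPart, hc τ hτ]
  have hhom' : ∀ b (g : Finset V → MvPolynomial V K) j, IsHomog j g →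
      IsHomog j (gradedPart b g) := by
    intro b c j hc τ hτ
    simp [gradedPart, hc τ hτ]
  constructor
  · intro h b c hc hcΔ hdc
    have hcb : ∀ τ, c τ ≠ 0 → sqfree τ ≤ b := fun τ hτ => (hcΔ τ hτ).1
    obtain ⟨q, hq, hqI, hdq⟩ := h (ofGradedPart b c) (hhom b c i hc) (hmem b c hcΔ) (by
      refine gradedPart_ext fun b' => ?_
      rw [gradedPart_koszulD, gradedPart_ofGradedPart hcb, gradedPart_zero]
      split_ifs <;> simp [hdc])
    refine ⟨gradedPart b q, hhom' b q _ hq, hmem' b q hqI, ?_⟩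
    rw [← gradedPart_koszulD, hdq, gradedPart_ofGradedPart hcb, if_pos rfl]
  · intro h g hg hgI hdg
    choose q hq hqΔ hdq using fun b => h b (gradedPart b g) (hhom' b g i hg) (hmem' b g hgI)
      (by rw [← gradedPart_koszulD, hdg, gradedPart_zero])
    have hqb : ∀ b τ, q b τ ≠ 0 → sqfree τ ≤ b := fun b τ hτ => (hqΔ b τ hτ).1
    let B : Finset (V →₀ ℕ) := Finset.univ.biUnion fun τ => (g τ).support.image (· + sqfree τ)
    have hB : ∀ b ∉ B, gradedPart b g = 0 := by
      intro b hb
      ext τ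
      by_contra hne
      have hΔ := hmem' b g hgI τ hne
      rw [gradedPart, if_pos hΔ.1] at hne
      refine hb (Finset.mem_biUnion.2 ⟨τ, Finset.mem_univ _, Finset.mem_image.2
        ⟨_, mem_support_iff.2 hne, tsub_add_cancel_of_le hΔ.1⟩⟩)
    refine ⟨∑ b ∈ B, ofGradedPart b (q b), IsHomog.sum fun b _ => hhom b _ _ (hq b),
      fun τ => ?_, ?_⟩
    · rw [Finset.sum_apply]
      exact I.sum_mem fun b _ => hmem b _ (hqΔ b) τ
    · refine gradedPart_ext fun b => ?_
      rw [gradedPart_koszulD, gradedPart_sum]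
      simp only [gradedPart_ofGradedPart (hqb _), Finset.sum_ite_eq']
      split_ifs with hb
      · exact hdq b
      · rw [map_zero, hB b hb]

/-- A cone has vanishing homology. -/
lemma faceExact_of_cone {Δ : Finset V → Prop} {v : V}
    (hv : ∀ τ, Δ τ → Δ (insert v τ)) (i : ℕ) : FaceExact K Δ i := by
  intro c hc hcΔ hdc
  refine ⟨wedge K K v c, hc.wedge v, fun τ hτ => ?_, ?_⟩
  · rw [wedge_apply] at hτ
    split_ifs at hτ with h
    · rw [← Finset.insert_erase h]
      exact hv _ (hcΔ _ (right_ne_zero_of_smul hτ))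
    · exact absurd rfl hτ
  · rw [koszulD_wedge, hdc, map_zero, sub_zero, one_smul]

/-- The polynomial ring has vanishing Koszul homology in positive degrees. -/
lemma koszulExact_univ {i : ℕ} (hi : i ≠ 0) :
    KoszulExact (X : V → MvPolynomial V K) (fun _ => (Set.univ : Set (MvPolynomial V K))) i := by
  have := (koszulExact_monomialIdeal_iff (K := K) (V := V) (P := fun _ => True) (I := ⊤)
    (by simp) i).2 (by
      intro b
      by_cases hb : b = 0
      · intro c hc hcΔ _
        have hc0 : c = 0 := by
          ext τ
          by_contra hne
          have hle := (hcΔ τ hne).1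
          by_cases hτ : τ.card = i
          · obtain ⟨v, hv⟩ := Finset.card_pos.1 (by omega : 0 < τ.card)
            have := hle v
            simp [sqfree_apply, hv, hb] at this
          · exact hne (hc τ hτ)
        exact ⟨0, fun _ _ => rfl, fun _ h => absurd rfl h, by rw [hc0, map_zero]⟩
      · obtain ⟨v, hv⟩ := Finsupp.ne_iff.1 hb
        refine faceExact_of_cone (v := v) (fun τ hτ => ⟨fun w => ?_, trivial⟩) i
        have := hτ.1 w
        rw [sqfree_apply] at this ⊢
        by_cases hw : w = v
        · subst hw
          simp only [Finsupp.coe_zero, Pi.zero_apply] at hv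
          simp; omega
        · simpa [hw] using this)
  simpa using this

end Graded

section Depth

open MvPolynomial

variable {V K : Type*} [Field K]

lemma one_notMem_span_range_X :
    (1 : MvPolynomial V K) ∉ Ideal.span (Set.range (X : V → MvPolynomial V K)) := by
  intro h
  have hle : Ideal.span (Set.range (X : V → MvPolynomial V K)) ≤
      RingHom.ker (constantCoeff (R := K) (σ := V)) := by
    rw [Ideal.span_le]
    rintro _ ⟨v, rfl⟩
    simp
  simpa using hle h

/-- The lengths of the regular sequences whose supremum is `depthQ K I`. -/
def regularLengths (I : Ideal (MvPolynomial V K)) : Set ℕ :=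
  {n | ∃ rs : List (MvPolynomial V K), rs.length = n ∧
    (∀ f ∈ rs, f ∈ Ideal.span (Set.range (MvPolynomial.X : V → MvPolynomial V K))) ∧
    RingTheory.Sequence.IsRegular (MvPolynomial V K ⧸ I) rs}

variable [LinearOrder V] [Fintype V] {I : Ideal (MvPolynomial V K)}

lemma le_of_mem_regularLengths_of_not_koszulExact {n k : ℕ} (hk : k ≠ 0)
    (hn : n ∈ regularLengths I)
    (h : ¬ KoszulExact (X : V → MvPolynomial V K) (fun _ => (I : Set (MvPolynomial V K))) k) :
    n + k + 1 ≤ Fintype.card V := by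
  obtain ⟨rs, rfl, hmem, hrs⟩ := hn
  by_contra hlt
  exact h ((koszulExact_quotient_iff (koszulExact_univ hk) (koszulExact_univ k.succ_ne_zero)).1
    (koszulExact_of_isWeaklyRegular X rs _ hrs.toIsWeaklyRegular hmem (k + 1) (by omega)))

lemma bddAbove_regularLengths
    (hI : I ≤ Ideal.span (Set.range (X : V → MvPolynomial V K))) :
    BddAbove (regularLengths I) := by
  refine ⟨Fintype.card V, ?_⟩
  rintro _ ⟨rs, rfl, hmem, hrs⟩
  by_contra hlt
  exact mk_one_notMem_smul_top hI one_notMem_span_range_X (mk_one_mem_of_koszulExact_zero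
    (koszulExact_of_isWeaklyRegular X rs _ hrs.toIsWeaklyRegular hmem 0 (by omega)))

lemma mem_regularLengths_of_koszulExact {k : ℕ} (hk : k ≠ 0) (hkV : k ≤ Fintype.card V)
    (hI : I ≤ Ideal.span (Set.range (X : V → MvPolynomial V K)))
    (h : ∀ i, k ≤ i →
      KoszulExact (X : V → MvPolynomial V K) (fun _ => (I : Set (MvPolynomial V K))) i) :
    Fintype.card V - k ∈ regularLengths I := by
  obtain ⟨rs, hlen, hmem, hrs⟩ := exists_isWeaklyRegular (X : V → MvPolynomial V K)
    (Fintype.card V - k) (MvPolynomial V K ⧸ I) (by omega) (by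
      rintro (_ | i) hi
      · omega
      · exact (koszulExact_quotient_iff (koszulExact_univ (by omega))
          (koszulExact_univ i.succ_ne_zero)).2 (h i (by omega)))
  refine ⟨rs, hlen, hmem, hrs, fun htop => ?_⟩
  refine mk_one_notMem_smul_top hI one_notMem_span_range_X ?_
  have hle : Ideal.ofList rs ≤ Ideal.span (Set.range (X : V → MvPolynomial V K)) :=
    Ideal.span_le.2 hmem
  exact Submodule.smul_mono_left hle (htop ▸ Submodule.mem_top)

/-- If the Koszul homology of `I` vanishes above degree `k`, then the depth of the quotient is
`|V| - k - 1` precisely when it does not vanish in degree `k`. -/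
theorem depthQ_eq_iff {k : ℕ} (hk : k ≠ 0) (hkV : k + 1 ≤ Fintype.card V)
    (hI : I ≤ Ideal.span (Set.range (X : V → MvPolynomial V K)))
    (h : ∀ i, k < i →
      KoszulExact (X : V → MvPolynomial V K) (fun _ => (I : Set (MvPolynomial V K))) i) :
    depthQ K I = Fintype.card V - k - 1 ↔
      ¬ KoszulExact (X : V → MvPolynomial V K) (fun _ => (I : Set (MvPolynomial V K))) k := by
  have hdef : depthQ K I = sSup (regularLengths I) := rfl
  have hmem := mem_regularLengths_of_koszulExact k.succ_ne_zero hkV hI h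
  constructor
  · intro hd hex
    have hmem' := mem_regularLengths_of_koszulExact hk (by omega) hI fun i hi => by
      rcases hi.eq_or_lt with rfl | hi
      · exact hex
      · exact h i hi
    have := le_csSup (bddAbove_regularLengths hI) hmem'
    omega
  · intro hex
    refine le_antisymm (csSup_le ⟨_, hmem⟩ fun n hn => ?_)
      (le_csSup (bddAbove_regularLengths hI) hmem)
    have := le_of_mem_regularLengths_of_not_koszulExact hk hn hex
    omega

end Depth
end DS

namespace DS

section Combinatorics

variable {V K : Type*}

lemma IsOrderedMatching.snoc {G : SimpleGraph V} {s : ℕ} {u v : Fin s → V}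
    (h : IsOrderedMatching G u v) {a b : V} (hab : G.Adj a b)
    (hu : ∀ i, u i ≠ a ∧ u i ≠ b ∧ ¬ G.Adj a (u i))
    (hv : ∀ i, v i ≠ a ∧ v i ≠ b ∧ ¬ G.Adj a (v i)) :
    IsOrderedMatching G (Fin.snoc u a : Fin (s + 1) → V) (Fin.snoc v b : Fin (s + 1) → V) := by
  obtain ⟨⟨hinj, hadj⟩, hind, hord⟩ := h
  rw [Sum.elim_injective] at hinj
  obtain ⟨hui, hvi, huv⟩ := hinj
  refine ⟨⟨?_, ?_⟩, ?_, ?_⟩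
  · rw [Sum.elim_injective]
    refine ⟨Fin.snoc_injective_iff.2 ⟨hui, ?_⟩, Fin.snoc_injective_iff.2 ⟨hvi, ?_⟩, ?_⟩
    · rintro ⟨i, hi⟩; exact (hu i).1 hi
    · rintro ⟨i, hi⟩; exact (hv i).2.1 hi
    · intro i j
      refine Fin.lastCases ?_ (fun i => ?_) i <;> refine Fin.lastCases ?_ (fun j => ?_) j
      · simpa using hab.ne
      · simpa using (hv j).1.symm
      · simpa using (hu i).2.1
      · simpa using huv i j
  · intro i
    refine Fin.lastCases ?_ (fun i => ?_) i
    · simpa using hab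
    · simpa using hadj i
  · intro i j
    refine Fin.lastCases ?_ (fun i => ?_) i <;> refine Fin.lastCases ?_ (fun j => ?_) j
    · simp
    · simpa using (hu j).2.2
    · simpa [G.adj_comm] using (hu i).2.2
    · simpa using hind i j
  · intro i j
    refine Fin.lastCases ?_ (fun i => ?_) i <;> refine Fin.lastCases ?_ (fun j => ?_) j
    · simp
    · intro h; simp at h; exact absurd h (hv j).2.2
    · intro; exact Fin.le_last _
    · intro h; simpa using hord i j (by simpa using h)

variable [LinearOrder V] [Field K]

/-- A chain on `Δ` can be moved off the vertex `v` if its contraction bounds in a complex `L`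
contained in the deletion of `v`. -/
lemma sub_wedge_contract_add_mem {Δ D L : Finset V → Prop} {v : V} {c y : Finset V → K}
    (hc : ∀ τ, c τ ≠ 0 → Δ τ) (hy : ∀ τ, y τ ≠ 0 → L τ)
    (hΔ : ∀ τ, v ∉ τ → Δ τ → D τ) (hL : ∀ τ, L τ → D τ) (τ : Finset V)
    (hτ : (c - wedge K K v (contract K K v c) + y) τ ≠ 0) : D τ := by
  by_cases hyτ : y τ = 0
  · have h1 : (c - wedge K K v (contract K K v c)) τ ≠ 0 := by simpa [hyτ] using hτ
    by_cases hv : v ∈ τ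
    · rw [← contract_wedge_self, contract_apply, if_pos hv] at h1
      exact absurd rfl h1
    · rw [Pi.sub_apply, wedge_apply, if_neg hv, sub_zero] at h1
      exact hΔ τ hv (hc τ h1)
  · exact hL τ (hy τ hyτ)

lemma contract_mem {Δ L : Finset V → Prop} {v : V} {c : Finset V → K}
    (hc : ∀ τ, c τ ≠ 0 → Δ τ) (hL : ∀ τ, v ∉ τ → Δ (insert v τ) → L τ) (τ : Finset V)
    (hτ : contract K K v c τ ≠ 0) : L τ := by
  rw [contract_apply] at hτ
  split_ifs at hτ with h
  · exact absurd rfl hτ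
  · exact hL τ h (hc _ (right_ne_zero_of_smul hτ))

lemma wedge_mem {Δ L : Finset V → Prop} {v : V} {c : Finset V → K}
    (hc : ∀ τ, c τ ≠ 0 → L τ) (hL : ∀ τ, L τ → Δ (insert v τ)) (τ : Finset V)
    (hτ : wedge K K v c τ ≠ 0) : Δ τ := by
  rw [wedge_apply] at hτ
  split_ifs at hτ with h
  · rw [← Finset.insert_erase h]
    exact hL _ (hc _ (right_ne_zero_of_smul hτ))
  · exact absurd rfl hτ

variable [Fintype V]

lemma faceExact_of_not_face {Δ : Finset V → Prop} (hΔ : ∀ τ, ¬ Δ τ) (i : ℕ) :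
    FaceExact K Δ i := by
  intro c _ hcΔ _
  have hc0 : c = 0 := by
    ext τ
    by_contra hne
    exact hΔ τ (hcΔ τ hne)
  exact ⟨0, fun _ _ => rfl, fun _ h => absurd rfl h, by rw [hc0, map_zero]⟩

lemma faceExact_congr {Δ Δ' : Finset V → Prop} (h : ∀ τ, Δ τ ↔ Δ' τ) {i : ℕ} :
    FaceExact K Δ i ↔ FaceExact K Δ' i := by
  rw [show Δ = Δ' from funext fun τ => propext (h τ)]

/-- Mayer–Vietoris for the covering of `Δ` by the deletion `D` and the star of `v`. -/
lemma faceExact_of_link_of_deletion {Δ D L : Finset V → Prop} {v : V} {i : ℕ}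
    (hLΔ : ∀ τ, L τ → Δ (insert v τ)) (hΔL : ∀ τ, v ∉ τ → Δ (insert v τ) → L τ)
    (hLD : ∀ τ, L τ → D τ) (hDΔ : ∀ τ, D τ → Δ τ) (hΔD : ∀ τ, v ∉ τ → Δ τ → D τ)
    (hL : FaceExact K L i) (hD : FaceExact K D (i + 1)) : FaceExact K Δ (i + 1) := by
  intro c hc hcΔ hdc
  obtain ⟨y, hy, hyL, hdy⟩ := hL (contract K K v c) (hc.contract v) (contract_mem hcΔ hΔL)
    (by rw [← neg_eq_zero, ← contract_koszulD, hdc, map_zero])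
  have key : koszulD K (fun _ => (1 : K)) (wedge K K v y) =
      -wedge K K v (contract K K v c) + y := by
    rw [koszulD_wedge, hdy, one_smul]; abel
  obtain ⟨q, hq, hqD, hdq⟩ := hD (c - wedge K K v (contract K K v c) + y)
    ((hc.sub ((hc.contract v).wedge v)).add hy) (sub_wedge_contract_add_mem hcΔ hyL hΔD hLD)
    (by rw [sub_eq_add_neg, add_assoc, ← key, map_add, koszulD_koszulD, hdc, add_zero])
  refine ⟨q - wedge K K v y, hq.sub (hy.wedge v), fun τ hτ => ?_, ?_⟩
  · by_cases hqτ : q τ = 0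
    · exact wedge_mem hyL hLΔ τ (by simpa [hqτ] using hτ)
    · exact hDΔ τ (hqD τ hqτ)
  · rw [map_sub, hdq, key]; abel

/-- If a complex `Δ` and the link `L` of `v` both have vanishing homology in degree `i`, then
so does the deletion of `v`. -/
lemma faceExact_deletion {Δ D L : Finset V → Prop} {v : V} {i : ℕ}
    (hΔL : ∀ τ, v ∉ τ → Δ (insert v τ) → L τ)
    (hLD : ∀ τ, L τ → D τ) (hDΔ : ∀ τ, D τ → Δ τ) (hΔD : ∀ τ, v ∉ τ → Δ τ → D τ)
    (hDv : ∀ τ, v ∈ τ → ¬ D τ)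
    (hL : FaceExact K L i) (hΔ : FaceExact K Δ i) : FaceExact K D i := by
  intro c hc hcD hdc
  obtain ⟨h, hh, hhΔ, hdh⟩ := hΔ c hc (fun τ hτ => hDΔ τ (hcD τ hτ)) hdc
  have hcv : contract K K v c = 0 := by
    ext τ
    rw [contract_apply]
    split_ifs with hτ
    · rfl
    · have : c (insert v τ) = 0 := by
        by_contra hne
        exact hDv _ (Finset.mem_insert_self v τ) (hcD _ hne)
      rw [this, smul_zero]; rfl
  obtain ⟨y, hy, hyL, hdy⟩ := hL (contract K K v h) (hh.contract v) (contract_mem hhΔ hΔL)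
    (by rw [← neg_eq_zero, ← contract_koszulD, hdh, hcv])
  have key : koszulD K (fun _ => (1 : K)) (wedge K K v y) =
      -wedge K K v (contract K K v h) + y := by
    rw [koszulD_wedge, hdy, one_smul]; abel
  refine ⟨h - wedge K K v (contract K K v h) + y, (hh.sub ((hh.contract v).wedge v)).add hy,
    sub_wedge_contract_add_mem hhΔ hyL hΔD hLD, ?_⟩
  rw [sub_eq_add_neg, add_assoc, ← key, map_add, koszulD_koszulD, hdh, add_zero]

/-- The independence complex of the subgraph of `G` on `W` formed by the edges of weight at
most `N`. -/
def thresholdIndep (G : SimpleGraph V) (a : V → ℕ) (N : ℕ) (W τ : Finset V) : Prop :=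
  τ ⊆ W ∧ ∀ u ∈ τ, ∀ v ∈ τ, G.Adj u v → N < a u + a v

/-- Homology of a threshold independence complex vanishes in degrees exceeding the size of
every ordered matching. -/
theorem faceExact_thresholdIndep (G : SimpleGraph V) (a : V → ℕ) (N : ℕ) (W : Finset V) :
    ∀ i, (∀ s (u v : Fin s → V), IsOrderedMatching G u v → (∀ k, u k ∈ W) → (∀ k, v k ∈ W) →
      s < i) → FaceExact K (thresholdIndep G a N W) i := by
  induction W using Finset.strongInduction with
  | H W ih =>
  intro i hi
  by_cases hiso : ∃ w ∈ W, ∀ w' ∈ W, G.Adj w w' → N < a w + a w'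
  · obtain ⟨w, hw, hiso⟩ := hiso
    refine faceExact_of_cone (v := w) (fun τ hτ => ⟨Finset.insert_subset hw hτ.1, ?_⟩) i
    intro u hu v hv huv
    rcases Finset.mem_insert.1 hu with rfl | hu' <;>
      rcases Finset.mem_insert.1 hv with rfl | hv'
    · exact absurd huv (G.irrefl)
    · exact hiso v (hτ.1 hv') huv
    · rw [add_comm]; exact hiso u (hτ.1 hu') huv.symm
    · exact hτ.2 u hu' v hv' huv
  push Not at hiso
  have hi0 : 0 < i := hi 0 Fin.elim0 Fin.elim0
    ⟨⟨fun x => (by rcases x with x | x <;> exact x.elim0), fun x => x.elim0⟩, fun x => x.elim0,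
      fun x => x.elim0⟩ (fun x => x.elim0) (fun x => x.elim0)
  obtain ⟨i, rfl⟩ : ∃ j, i = j + 1 := ⟨i - 1, by omega⟩
  rcases W.eq_empty_or_nonempty with rfl | hne
  · intro c hc hcΔ _
    have hc0 : c = 0 := by
      ext τ
      by_contra hne
      have := (hcΔ τ hne).1
      refine hne (hc τ ?_)
      rw [Finset.subset_empty.1 this]; simp
    exact ⟨0, fun _ _ => rfl, fun _ h => absurd rfl h, by rw [hc0, map_zero]⟩
  obtain ⟨v, hv, hmin⟩ := W.exists_min_image a hne
  obtain ⟨u, hu, hvu, huN⟩ := hiso v hv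
  classical
  let W2 : Finset V := W.filter fun w => w ≠ v ∧ (G.Adj v w → N < a v + a w)
  have hW2 : W2 ⊂ W := Finset.filter_ssubset.2 ⟨v, hv, by simp⟩
  refine faceExact_of_link_of_deletion (v := v) (D := thresholdIndep G a N (W.erase v))
    (L := thresholdIndep G a N W2) ?_ ?_ ?_ ?_ ?_ ?_ ?_
  · rintro τ ⟨hτ, hτ'⟩
    refine ⟨Finset.insert_subset hv (hτ.trans hW2.subset), ?_⟩
    intro x hx y hy hxy
    rcases Finset.mem_insert.1 hx with rfl | hx' <;>
      rcases Finset.mem_insert.1 hy with rfl | hy'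
    · exact absurd hxy (G.irrefl)
    · exact (Finset.mem_filter.1 (hτ hy')).2.2 hxy
    · rw [add_comm]; exact (Finset.mem_filter.1 (hτ hx')).2.2 hxy.symm
    · exact hτ' x hx' y hy' hxy
  · rintro τ hvτ ⟨hτ, hτ'⟩
    refine ⟨fun w hw => Finset.mem_filter.2 ⟨hτ (Finset.mem_insert_of_mem hw), ?_, ?_⟩, ?_⟩
    · rintro rfl; exact hvτ hw
    · exact hτ' v (Finset.mem_insert_self v τ) w (Finset.mem_insert_of_mem hw)
    · exact fun x hx y hy =>
        hτ' x (Finset.mem_insert_of_mem hx) y (Finset.mem_insert_of_mem hy)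
  · exact fun τ hτ => ⟨fun w hw => Finset.mem_erase.2
      ⟨(Finset.mem_filter.1 (hτ.1 hw)).2.1, hW2.subset (hτ.1 hw)⟩, hτ.2⟩
  · exact fun τ hτ => ⟨hτ.1.trans (Finset.erase_subset v W), hτ.2⟩
  · exact fun τ hvτ hτ => ⟨Finset.subset_erase.2 ⟨hτ.1, hvτ⟩, hτ.2⟩
  · by_cases hadj : ∃ w ∈ W2, G.Adj v w
    · obtain ⟨w, hw, hvw⟩ := hadj
      refine faceExact_of_cone (v := w) (fun τ hτ => ⟨Finset.insert_subset hw hτ.1, ?_⟩) i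
      have hwN := (Finset.mem_filter.1 hw).2.2 hvw
      have haux : ∀ y ∈ τ, N < a w + a y := fun y hy => by
        have := hmin y (hW2.subset (hτ.1 hy))
        omega
      intro x hx y hy hxy
      rcases Finset.mem_insert.1 hx with rfl | hx' <;>
        rcases Finset.mem_insert.1 hy with rfl | hy'
      · exact absurd hxy (G.irrefl)
      · exact haux y hy'
      · rw [add_comm]; exact haux x hx'
      · exact hτ.2 x hx' y hy' hxy
    · push Not at hadj
      refine ih W2 hW2 i fun s p q hpq hp hq => ?_
      have haux : ∀ w ∈ W2, w ≠ v ∧ w ≠ u ∧ ¬ G.Adj v w := fun w hw =>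
        ⟨(Finset.mem_filter.1 hw).2.1, by rintro rfl; exact hadj _ hw hvu, hadj w hw⟩
      have := hi (s + 1) _ _ (hpq.snoc hvu (fun k => haux _ (hp k)) fun k => haux _ (hq k))
        (fun k => Fin.lastCases (by simpa using hv) (fun k => by
          simpa using hW2.subset (hp k)) k)
        (fun k => Fin.lastCases (by simpa using hu) (fun k => by
          simpa using hW2.subset (hq k)) k)
      omega
  · exact ih (W.erase v) (Finset.erase_ssubset hv) (i + 1) fun s p q hpq hp hq =>
      hi s p q hpq (fun k => Finset.mem_of_mem_erase (hp k))
        fun k => Finset.mem_of_mem_erase (hq k)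

/-- The monomials of the symbolic power `J(G[W])^{(n)}`. -/
def IsCover (G : SimpleGraph V) (n : ℕ) (W : Finset V) (m : V →₀ ℕ) : Prop :=
  ∀ u ∈ W, ∀ v ∈ W, G.Adj u v → n ≤ m u + m v

/-- The upper Koszul complex of `J(G[W])^{(n)}` in multidegree `b`. -/
def coverComplex (G : SimpleGraph V) (n : ℕ) (W : Finset V) (b : V →₀ ℕ) (τ : Finset V) : Prop :=
  τ ⊆ W ∧ sqfree τ ≤ b ∧ IsCover G n W (b - sqfree τ)

theorem faceExact_coverComplex (G : SimpleGraph V) (n : ℕ) (b : V →₀ ℕ) (i : ℕ)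
    (hi : ∀ s (u v : Fin s → V), IsOrderedMatching G u v → s < i) :
    FaceExact K (coverComplex G n Finset.univ b) i := by
  classical
  by_cases hb : ∃ u v, G.Adj u v ∧ b u + b v < n
  · obtain ⟨u, v, huv, hlt⟩ := hb
    refine faceExact_of_not_face (fun τ hτ => ?_) i
    have := hτ.2.2 u (Finset.mem_univ u) v (Finset.mem_univ v) huv
    simp only [Finsupp.tsub_apply] at this
    omega
  push Not at hb
  let W : Finset V := Finset.univ.filter fun u => 1 ≤ b u ∧ ∀ v, G.Adj u v → n + 1 ≤ b u + b v
  refine (faceExact_congr (Δ' := thresholdIndep G b (n + 1) W) fun τ => ⟨?_, ?_⟩).2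
    (faceExact_thresholdIndep G b (n + 1) W i fun s u v h _ _ => hi s u v h)
  · rintro ⟨-, hτ, hcov⟩
    have h1 : ∀ u ∈ τ, 1 ≤ b u := fun u hu => by simpa [sqfree_apply, hu] using hτ u
    have h2 : ∀ u v, G.Adj u v → n ≤ b u - (if u ∈ τ then 1 else 0) +
        (b v - (if v ∈ τ then 1 else 0)) := fun u v huv => by
      simpa [sqfree_apply] using hcov u (Finset.mem_univ u) v (Finset.mem_univ v) huv
    refine ⟨fun u hu => Finset.mem_filter.2 ⟨Finset.mem_univ u, h1 u hu, fun v huv => ?_⟩,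
      fun u hu v hv huv => ?_⟩
    · have := h2 u v huv
      have := h1 u hu
      rw [if_pos hu] at *
      omega
    · have := h2 u v huv
      have := h1 u hu
      have := h1 v hv
      rw [if_pos hu, if_pos hv] at *
      omega
  · rintro ⟨hτW, hτ⟩
    have h1 : ∀ u ∈ τ, 1 ≤ b u ∧ ∀ v, G.Adj u v → n + 1 ≤ b u + b v := fun u hu => by
      simpa [W] using hτW hu
    refine ⟨Finset.subset_univ τ, fun u => ?_, fun u _ v _ huv => ?_⟩
    · rw [sqfree_apply]
      split_ifs with hu
      · exact (h1 u hu).1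
      · exact Nat.zero_le _
    · rw [Finsupp.tsub_apply, Finsupp.tsub_apply, sqfree_apply, sqfree_apply]
      have := hb u v huv
      split_ifs with hu hv hv
      · have := hτ u hu v hv huv
        omega
      · have := (h1 u hu).2 v huv
        omega
      · have := (h1 v hv).2 u huv.symm
        omega
      · omega

/-- Vanishing of homology passes to the cover ideal of the graph with one vertex removed. -/
lemma faceExact_coverComplex_erase {G : SimpleGraph V} {n i : ℕ} {W : Finset V} {v : V}
    (hv : v ∉ W) (h : ∀ b, FaceExact K (coverComplex G n (insert v W) b) i) (b : V →₀ ℕ) :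
    FaceExact K (coverComplex G n W b) i := by
  classical
  let D : ℕ → Finset V → Prop := fun k τ =>
    τ ⊆ W ∧ coverComplex G n (insert v W) (b.update v k) τ
  have hD : ∀ k, FaceExact K (D k) i := by
    intro k
    induction k with
    | zero =>
      refine (faceExact_congr fun τ => ⟨fun hτ => hτ.2, fun hτ => ⟨fun w hw => ?_, hτ⟩⟩).2
        (h (b.update v 0))
      refine Finset.mem_of_mem_insert_of_ne (hτ.1 hw) ?_
      rintro rfl
      have := hτ.2.1 w
      simp [sqfree_apply, hw] at this
    | succ k ih =>
      refine faceExact_deletion (v := v) (L := D k) ?_ ?_ (fun τ hτ => hτ.2) ?_ ?_ ih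
        (h (b.update v (k + 1)))
      · rintro τ hvτ ⟨h1, h2, h3⟩
        have hsub : τ ⊆ W := fun w hw =>
          Finset.mem_of_mem_insert_of_ne (h1 (Finset.mem_insert_of_mem hw)) (by
            rintro rfl; exact hvτ hw)
        have hupd : b.update v (k + 1) = b.update v k + Finsupp.single v 1 := by
          ext w
          by_cases hw : w = v
          · subst hw; simp
          · simp [hw]
        rw [sqfree_insert hvτ, hupd] at h2 h3
        rw [add_tsub_add_eq_tsub_right] at h3
        exact ⟨hsub, hsub.trans (Finset.subset_insert v W), le_of_add_le_add_right h2, h3⟩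
      · rintro τ ⟨h0, h1, h2, h3⟩
        have hle : b.update v k ≤ b.update v (k + 1) := fun w => by
          by_cases hw : w = v
          · subst hw; simp
          · simp [hw]
        refine ⟨h0, h1, h2.trans hle, fun x hx y hy hxy => (h3 x hx y hy hxy).trans ?_⟩
        exact add_le_add (tsub_le_tsub_right hle _ x) (tsub_le_tsub_right hle _ y)
      · exact fun τ hvτ hτ => ⟨fun w hw => Finset.mem_of_mem_insert_of_ne (hτ.1 hw) (by
          rintro rfl; exact hvτ hw), hτ⟩
      · exact fun τ hvτ hτ => hv (hτ.1 hvτ)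
  refine (faceExact_congr fun τ => ⟨fun hτ => ⟨hτ.1, hτ.1.trans (Finset.subset_insert v W), ?_, ?_⟩,
    fun hτ => ⟨hτ.1, ?_, ?_⟩⟩).2 (hD n)
  · intro w
    have := hτ.2.1 w
    by_cases hw : w = v
    · subst hw
      have : w ∉ τ := fun h => hv (hτ.1 h)
      simp [sqfree_apply, this]
    · simpa [Function.update_apply, hw] using this
  · have hvτ : v ∉ τ := fun h => hv (hτ.1 h)
    have hval : (b.update v n - sqfree τ) v = n := by simp [sqfree_apply, hvτ]
    have hval' : ∀ w ∈ W, (b.update v n - sqfree τ) w = (b - sqfree τ) w := fun w hw => by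
      have : w ≠ v := by rintro rfl; exact hv hw
      simp [this]
    intro x hx y hy hxy
    rcases Finset.mem_insert.1 hx with rfl | hx
    · omega
    · rcases Finset.mem_insert.1 hy with rfl | hy
      · omega
      · rw [hval' x hx, hval' y hy]; exact hτ.2.2 x hx y hy hxy
  · intro w
    have := hτ.2.2.1 w
    by_cases hw : w = v
    · subst hw
      have : w ∉ τ := fun h => hv (hτ.1 h)
      simp [sqfree_apply, this]
    · simpa [Function.update_apply, hw] using this
  · have hval' : ∀ w ∈ W, (b.update v n - sqfree τ) w = (b - sqfree τ) w := fun w hw => by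
      have : w ≠ v := by rintro rfl; exact hv hw
      simp [this]
    intro x hx y hy hxy
    rw [← hval' x hx, ← hval' y hy]
    exact hτ.2.2.2 x (Finset.mem_insert_of_mem hx) y (Finset.mem_insert_of_mem hy) hxy

theorem faceExact_coverComplex_of_univ {G : SimpleGraph V} {n i : ℕ}
    (h : ∀ b, FaceExact K (coverComplex G n Finset.univ b) i) (W : Finset V) :
    ∀ b, FaceExact K (coverComplex G n W b) i := by
  suffices ∀ T : Finset V, ∀ b, FaceExact K (coverComplex G n Tᶜ b) i by
    simpa using this Wᶜ
  intro T
  induction T using Finset.induction_on with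
  | empty => simpa using h
  | insert v T hv ih =>
    refine faceExact_coverComplex_erase (v := v) (by simp) ?_
    rwa [Finset.compl_insert, Finset.insert_erase (by simpa using hv)]

end Combinatorics
end DS

namespace DS

section SymbolicPower

open MvPolynomial

variable {V K : Type*} [Field K]

lemma mem_span_pair_pow_iff {u v : V} (huv : u ≠ v) (n : ℕ) (f : MvPolynomial V K) :
    f ∈ Ideal.span {(X u : MvPolynomial V K), X v} ^ n ↔ ∀ m ∈ f.support, n ≤ m u + m v := by
  classical
  constructor
  · intro hf
    induction n generalizing f with
    | zero => simp
    | succ n ih =>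
      rw [pow_succ] at hf
      induction hf using Submodule.mul_induction_on' with
      | mem_mul_mem a ha b hb =>
        intro m hm
        obtain ⟨p, hp, q, hq, rfl⟩ := Finset.mem_add.1 (support_mul a b hm)
        rw [← Set.image_pair, mem_ideal_span_X_image] at hb
        obtain ⟨i, hi, hqi⟩ := hb q hq
        have := ih a ha p hp
        simp only [Finsupp.add_apply]
        rcases hi with rfl | rfl <;> omega
      | add a _ b _ ha hb =>
        intro m hm
        rcases Finset.mem_union.1 (support_add hm) with h | h
        exacts [ha m h, hb m h]
  · intro hf
    rw [f.as_sum]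
    refine Ideal.sum_mem _ fun m hm => ?_
    have hle : Finsupp.single u (m u) + Finsupp.single v (m v) ≤ m := fun w => by
      simp only [Finsupp.add_apply, Finsupp.single_apply]
      split_ifs with h1 h2 h2
      · exact absurd (h1.trans h2.symm) huv
      · subst h1; simp
      · subst h2; simp
      · simp
    have heq : monomial m (coeff m f) = X u ^ m u * X v ^ m v *
        monomial (m - (Finsupp.single u (m u) + Finsupp.single v (m v))) (coeff m f) := by
      rw [X_pow_eq_monomial, X_pow_eq_monomial, monomial_mul, monomial_mul, one_mul, one_mul,
        add_tsub_cancel_of_le hle]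
    rw [heq]
    refine Ideal.mul_mem_right _ _ (Ideal.pow_le_pow_right (hf m hm) ?_)
    rw [pow_add]
    have hu : (X u : MvPolynomial V K) ∈ Ideal.span {(X u : MvPolynomial V K), X v} :=
      Ideal.subset_span (Set.mem_insert _ _)
    have hv : (X v : MvPolynomial V K) ∈ Ideal.span {(X u : MvPolynomial V K), X v} :=
      Ideal.subset_span (Set.mem_insert_of_mem _ rfl)
    exact Ideal.mul_mem_mul (Ideal.pow_mem_pow hu (m u)) (Ideal.pow_mem_pow hv (m v))

lemma mem_symbPow_iff (G : SimpleGraph V) (n : ℕ) (f : MvPolynomial V K) :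
    f ∈ symbPow K G n ↔ ∀ m ∈ f.support, ∀ u v, G.Adj u v → n ≤ m u + m v := by
  simp only [symbPow, Submodule.mem_iInf, Prod.forall]
  constructor
  · exact fun h m hm u v huv => (mem_span_pair_pow_iff huv.ne n f).1 (h u v huv) m hm
  · exact fun h u v huv => (mem_span_pair_pow_iff huv.ne n f).2 fun m hm => h m hm u v huv

lemma symbPow_le_span_range_X {G : SimpleGraph V} {a b : V} (hab : G.Adj a b) {n : ℕ}
    (hn : n ≠ 0) : symbPow K G n ≤ Ideal.span (Set.range X) := by
  intro f hf
  rw [← Set.image_univ, mem_ideal_span_X_image]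
  intro m hm
  have := (mem_symbPow_iff G n f).1 hf m hm a b hab
  by_cases h : m a = 0
  · exact ⟨b, trivial, by omega⟩
  · exact ⟨a, trivial, h⟩

lemma upperKoszul_isCover_univ [Fintype V] (G : SimpleGraph V) (n : ℕ) (b : V →₀ ℕ)
    (τ : Finset V) :
    upperKoszul (fun m => ∀ u v, G.Adj u v → n ≤ m u + m v) b τ ↔
      coverComplex G n Finset.univ b τ := by
  simp [upperKoszul, coverComplex, IsCover]

end SymbolicPower

section OrderedMatchingNumber

variable {V : Type*} [Fintype V] {G : SimpleGraph V}

lemma IsOrderedMatching.two_mul_le_card {s : ℕ} {u v : Fin s → V}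
    (h : IsOrderedMatching G u v) : 2 * s ≤ Fintype.card V := by
  have := Fintype.card_le_of_injective _ h.1.1
  simp only [Fintype.card_sum, Fintype.card_fin] at this
  omega

lemma bddAbove_isOrderedMatching :
    BddAbove {s | ∃ u v : Fin s → V, IsOrderedMatching G u v} := by
  refine ⟨Fintype.card V, ?_⟩
  rintro s ⟨u, v, h⟩
  have := h.two_mul_le_card
  omega

lemma IsOrderedMatching.le_nu0 {s : ℕ} {u v : Fin s → V} (h : IsOrderedMatching G u v) :
    s ≤ nu0 G := le_csSup bddAbove_isOrderedMatching ⟨u, v, h⟩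

lemma exists_isOrderedMatching_nu0 (G : SimpleGraph V) :
    ∃ u v : Fin (nu0 G) → V, IsOrderedMatching G u v :=
  Nat.sSup_mem (s := {s | ∃ u v : Fin s → V, IsOrderedMatching G u v})
    ⟨0, Fin.elim0, Fin.elim0, ⟨fun x => by rcases x with x | x <;> exact x.elim0,
      fun x => x.elim0⟩, fun x => x.elim0, fun x => x.elim0⟩ bddAbove_isOrderedMatching

lemma nu0_ne_zero {a b : V} (hab : G.Adj a b) : nu0 G ≠ 0 := by
  have h : IsOrderedMatching G (Fin.elim0 : Fin 0 → V) Fin.elim0 :=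
    ⟨⟨fun x => by rcases x with x | x <;> exact x.elim0, fun x => x.elim0⟩,
      fun x => x.elim0, fun x => x.elim0⟩
  have := (h.snoc hab (fun x => x.elim0) fun x => x.elim0).le_nu0
  omega

lemma exists_adj_of_nu0_ne_zero (h : nu0 G ≠ 0) : ∃ a b, G.Adj a b := by
  obtain ⟨u, v, huv⟩ := exists_isOrderedMatching_nu0 G
  exact ⟨_, _, huv.1.2 ⟨0, Nat.pos_of_ne_zero h⟩⟩

end OrderedMatchingNumber

theorem depthQ_symbPow_eq_iff {V K : Type*} [Field K] [LinearOrder V] [Fintype V]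
    {G : SimpleGraph V} {a b : V} (hab : G.Adj a b) {n : ℕ} (hn : n ≠ 0) :
    depthQ K (symbPow K G n) = Fintype.card V - nu0 G - 1 ↔
      ∃ b, ¬ FaceExact K (coverComplex G n Finset.univ b) (nu0 G) := by
  have hiff := fun i => koszulExact_monomialIdeal_iff (K := K) (mem_symbPow_iff G n) i
  simp only [faceExact_congr (upperKoszul_isCover_univ G n _)] at hiff
  have h0 := nu0_ne_zero hab
  obtain ⟨u, v, huv⟩ := exists_isOrderedMatching_nu0 G
  have hcard := huv.two_mul_le_card
  rw [depthQ_eq_iff h0 (by omega) (symbPow_le_span_range_X hab hn) fun i hi =>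
    (hiff i).2 fun b => faceExact_coverComplex G n b i fun s u v h => h.le_nu0.trans_lt hi,
    hiff, not_forall]

section Transport

variable {U V K : Type*} [LinearOrder U] [LinearOrder V] (e : U ↪o V)

lemma insertSign_map (u : U) (σ : Finset U) :
    insertSign (e u) (σ.map e.toEmbedding) = insertSign u σ := by
  simp only [insertSign]
  congr 1
  rw [Finset.filter_map, Finset.card_map]
  simp

variable [Fintype U] [Fintype V] [Field K]

lemma koszulD_comp_map {g : Finset V → K}
    (hg : ∀ τ, g τ ≠ 0 → τ ⊆ Finset.univ.map e.toEmbedding) :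
    (fun σ => koszulD K (fun _ => (1 : K)) g (Finset.map e.toEmbedding σ)) =
      koszulD K (fun _ => (1 : K)) (fun σ => g (Finset.map e.toEmbedding σ)) := by
  ext σ
  rw [koszulD_apply, koszulD_apply,
    ← Finset.sum_subset (Finset.subset_univ (Finset.univ.map e.toEmbedding)), Finset.sum_map]
  · refine Finset.sum_congr rfl fun u _ => ?_
    rw [contract_apply, contract_apply]
    have h1 := insertSign_map e u σ
    simp only [RelEmbedding.coe_toEmbedding, Finset.map_insert] at h1 ⊢
    simp [h1]
  · intro v _ hv
    rw [contract_apply]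
    split_ifs
    · simp
    · have : g (insert v (σ.map e.toEmbedding)) = 0 := by
        by_contra hne
        exact hv (hg _ hne (Finset.mem_insert_self _ _))
      rw [this]; simp

lemma faceExact_coverComplex_comap {G : SimpleGraph V} {n j : ℕ}
    (h : ∀ b, FaceExact K (coverComplex G n (Finset.univ.map e.toEmbedding) b) j) (b : U →₀ ℕ) :
    FaceExact K (coverComplex (G.comap e) n Finset.univ b) j := by
  have hinj : Function.Injective (Finset.map e.toEmbedding) := Finset.map_injective _
  have hsq : ∀ σ u, sqfree (σ.map e.toEmbedding) (e u) = sqfree σ u := fun σ u => by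
    simp [sqfree_apply]
  have hb : ∀ u, b.embDomain e.toEmbedding (e u) = b u :=
    fun u => Finsupp.embDomain_apply_self e.toEmbedding b u
  have hface : ∀ σ, coverComplex G n (Finset.univ.map e.toEmbedding)
      (b.embDomain e.toEmbedding) (σ.map e.toEmbedding) ↔
        coverComplex (G.comap e) n Finset.univ b σ := by
    intro σ
    refine and_congr (by simp) (and_congr ⟨fun H u => ?_, fun H v => ?_⟩ ?_)
    · rw [← hsq, ← hb]; exact H (e u)
    · by_cases hv : v ∈ Set.range e
      · obtain ⟨u, rfl⟩ := hv
        rw [hsq, hb]; exact H u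
      · have : v ∉ σ.map e.toEmbedding := fun hvσ => by
          obtain ⟨u, -, rfl⟩ := Finset.mem_map.1 hvσ
          exact hv ⟨u, rfl⟩
        simp [sqfree_apply, this]
    · simp only [IsCover, Finset.mem_map, Finset.mem_univ, true_and, forall_exists_index,
        forall_apply_eq_imp_iff, RelEmbedding.coe_toEmbedding, Finsupp.tsub_apply, hsq, hb,
        SimpleGraph.comap_adj, forall_const]
  intro c hc hcΔ hdc
  let c' : Finset V → K := Function.extend (Finset.map e.toEmbedding) c 0
  have hc' : ∀ σ, c' (σ.map e.toEmbedding) = c σ := fun σ => hinj.extend_apply c 0 σ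
  have hsupp : ∀ τ, c' τ ≠ 0 → ∃ σ, σ.map e.toEmbedding = τ ∧ c σ ≠ 0 := fun τ hτ => by
    by_cases h : ∃ σ, Finset.map e.toEmbedding σ = τ
    · obtain ⟨σ, rfl⟩ := h
      exact ⟨σ, rfl, by rwa [hc'] at hτ⟩
    · exact absurd (Function.extend_apply' c (0 : Finset V → K) τ h) hτ
  have hsub : ∀ τ, c' τ ≠ 0 → τ ⊆ Finset.univ.map e.toEmbedding := fun τ hτ => by
    obtain ⟨σ, rfl, -⟩ := hsupp τ hτ
    exact Finset.map_subset_map.2 (Finset.subset_univ σ)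
  obtain ⟨q, hq, hqΔ, hdq⟩ := h (b.embDomain e.toEmbedding) c' (fun τ hτ => by
      by_contra hne
      obtain ⟨σ, rfl, hσ⟩ := hsupp τ hne
      exact hσ (hc σ (by rwa [Finset.card_map] at hτ)))
    (fun τ hτ => by
      obtain ⟨σ, rfl, hσ⟩ := hsupp τ hτ
      exact (hface σ).2 (hcΔ σ hσ))
    (by
      ext τ
      by_cases hτ : τ ⊆ Finset.univ.map e.toEmbedding
      · obtain ⟨σ, -, rfl⟩ := Finset.subset_map_iff.1 hτ
        rw [congrFun (koszulD_comp_map e hsub) σ]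
        simp only [hc']
        exact congrFun hdc σ
      · rw [koszulD_apply]
        refine Finset.sum_eq_zero fun v _ => ?_
        rw [contract_apply]
        split_ifs
        · simp
        · have : c' (insert v τ) = 0 := by
            by_contra hne
            exact hτ ((Finset.subset_insert v τ).trans (hsub _ hne))
          rw [this]; simp)
  refine ⟨fun σ => q (σ.map e.toEmbedding), fun σ hσ => hq _ (by rwa [Finset.card_map]),
    fun σ hσ => (hface σ).1 (hqΔ _ hσ), ?_⟩
  rw [← koszulD_comp_map e fun τ hτ => (hqΔ τ hτ).1, hdq]
  exact funext hc'

end Transport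

section Nonvanishing

variable {V K : Type*} [LinearOrder V] [Fintype V] [Field K]

/-- The fundamental cycle of the boundary of a cross-polytope. -/
lemma exists_crossPolytope_cycle (K : Type*) [Field K] {s : ℕ} {u v : Fin s → V}
    (huv : Function.Injective (Sum.elim u v)) :
    ∃ z : Finset V → K, IsHomog s z ∧ koszulD K (fun _ => (1 : K)) z = 0 ∧ z ≠ 0 ∧
      ∀ τ, z τ ≠ 0 → (∀ x ∈ τ, x ∈ Set.range (Sum.elim u v)) ∧ ∀ i, u i ∈ τ → v i ∉ τ := by
  induction s with
  | zero =>
    refine ⟨Pi.single ∅ (1 : K), fun τ hτ => ?_, ?_, ?_, fun τ hτ => ?_⟩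
    · rw [Pi.single_eq_of_ne]; rintro rfl; simp at hτ
    · ext τ
      rw [koszulD_apply]
      refine Finset.sum_eq_zero fun w _ => ?_
      rw [contract_apply, Pi.single_eq_of_ne (Finset.insert_ne_empty w τ)]
      simp
    · exact fun h => one_ne_zero (α := K) (by simpa using congrFun h ∅)
    · have : τ = ∅ := by by_contra h; exact hτ (Pi.single_eq_of_ne h _)
      subst this
      exact ⟨by simp, fun i => i.elim0⟩
  | succ s ih =>
    have hinj := Sum.elim_injective.1 huv
    obtain ⟨hu, hv, hne⟩ := hinj
    obtain ⟨y, hy, hdy, hy0, hyτ⟩ := ih (u := fun i => u i.castSucc) (v := fun i => v i.castSucc)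
      (Sum.elim_injective.2 ⟨hu.comp (Fin.castSucc_injective s),
        hv.comp (Fin.castSucc_injective s), fun i j => hne _ _⟩)
    set a := u (Fin.last s) with ha
    set b := v (Fin.last s) with hb
    have hnot : ∀ τ, y τ ≠ 0 → a ∉ τ ∧ b ∉ τ := by
      intro τ hτ
      constructor
      · intro h
        obtain ⟨i | i, hi⟩ := (hyτ τ hτ).1 _ h
        · exact (Fin.castSucc_lt_last i).ne (hu hi)
        · exact hne _ _ hi.symm
      · intro h
        obtain ⟨i | i, hi⟩ := (hyτ τ hτ).1 _ h
        · exact hne _ _ hi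
        · exact (Fin.castSucc_lt_last i).ne (hv hi)
    have hya : contract K K a y = 0 := by
      ext τ
      rw [contract_apply]
      split_ifs with h
      · rfl
      · have : y (insert a τ) = 0 := by
          by_contra h'
          exact (hnot _ h').1 (Finset.mem_insert_self _ _)
        rw [this]; simp
    refine ⟨wedge K K a y - wedge K K b y, (hy.wedge a).sub (hy.wedge b), ?_, fun h => hy0 ?_,
      fun τ hτ => ?_⟩
    · rw [map_sub, koszulD_wedge, koszulD_wedge, hdy, map_zero, map_zero, sub_self]
    · have := congrArg (contract K K a) h
      rwa [map_sub, contract_wedge_self, contract_wedge_of_ne (hne _ _), hya, map_zero, map_zero,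
        neg_zero, sub_zero, sub_zero, map_zero] at this
    · have hor : ∃ w σ, (w = a ∨ w = b) ∧ y σ ≠ 0 ∧ τ = insert w σ := by
        by_cases h : wedge K K a y τ = 0
        · rw [Pi.sub_apply, h, zero_sub, neg_ne_zero, wedge_apply] at hτ
          split_ifs at hτ with hbτ
          · exact ⟨b, τ.erase b, Or.inr rfl, right_ne_zero_of_smul hτ,
              (Finset.insert_erase hbτ).symm⟩
          · exact absurd rfl hτ
        · rw [wedge_apply] at h
          split_ifs at h with haτ
          · exact ⟨a, τ.erase a, Or.inl rfl, right_ne_zero_of_smul h,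
              (Finset.insert_erase haτ).symm⟩
          · exact absurd rfl h
      obtain ⟨w, σ, hw, hσ, rfl⟩ := hor
      obtain ⟨h1, h2⟩ := hyτ σ hσ
      obtain ⟨haσ, hbσ⟩ := hnot σ hσ
      refine ⟨fun x hx => ?_, fun i => ?_⟩
      · rcases Finset.mem_insert.1 hx with rfl | hx
        · rcases hw with rfl | rfl
          exacts [⟨Sum.inl (Fin.last s), rfl⟩, ⟨Sum.inr (Fin.last s), rfl⟩]
        · obtain ⟨i | i, hi⟩ := h1 x hx
          exacts [⟨Sum.inl i.castSucc, hi⟩, ⟨Sum.inr i.castSucc, hi⟩]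
      · refine Fin.lastCases ?_ (fun i => ?_) i
        · rw [← ha, ← hb]
          have hab : a ≠ b := hne _ _
          rcases hw with rfl | rfl <;> simp [haσ, hbσ, hab, hab.symm]
        · have h3 : u i.castSucc ≠ w ∧ v i.castSucc ≠ w := by
            rcases hw with rfl | rfl
            · exact ⟨fun h => (Fin.castSucc_lt_last i).ne (hu h), (hne _ _).symm⟩
            · exact ⟨hne _ _, fun h => (Fin.castSucc_lt_last i).ne (hv h)⟩
          simpa [h3.1, h3.2] using h2 i

theorem exists_not_faceExact_coverComplex {G : SimpleGraph V} {s n : ℕ} {u v : Fin s → V}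
    (h : IsOrderedMatching G u v) (hn : 2 * s ≤ n) :
    ∃ b, ¬ FaceExact K (coverComplex G n Finset.univ b) s := by
  classical
  by_contra! hall
  obtain ⟨⟨hinj, hadj⟩, hind, hord⟩ := h
  let b : V →₀ ℕ := Finsupp.equivFunOnFinite.symm (Function.extend (Sum.elim u v)
    (Sum.elim (fun i => s - i) fun i => n + 1 - (s - i)) 0)
  have hbu : ∀ i, b (u i) = s - i := fun i => hinj.extend_apply _ _ (Sum.inl i)
  have hbv : ∀ i, b (v i) = n + 1 - (s - i) := fun i => hinj.extend_apply _ _ (Sum.inr i)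
  let W : Finset V := Finset.univ.image (Sum.elim u v)
  obtain ⟨z, hz, hdz, hz0, hzτ⟩ := exists_crossPolytope_cycle K hinj
  have hsq : ∀ (τ : Finset V) x, sqfree τ x ≤ 1 := fun τ x => by
    rw [sqfree_apply]; split_ifs <;> simp
  obtain ⟨q, hq, hqΔ, hdq⟩ := faceExact_coverComplex_of_univ hall W b z hz (fun τ hτ => by
      obtain ⟨h1, h2⟩ := hzτ τ hτ
      have hpair : ∀ i, sqfree τ (u i) + sqfree τ (v i) ≤ 1 := fun i => by
        have := h2 i
        rw [sqfree_apply, sqfree_apply]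
        split_ifs <;> simp_all
      have huvn : ∀ i j, G.Adj (u i) (v j) →
          n ≤ b (u i) - sqfree τ (u i) + (b (v j) - sqfree τ (v j)) := fun i j hij => by
        have := hord i j hij
        have h3 := hsq τ (u i)
        have h4 := hsq τ (v j)
        have h5 := hpair i
        rw [hbu, hbv]
        rcases this.eq_or_lt with rfl | hlt
        · omega
        · have : (i : ℕ) < j := hlt
          omega
      refine ⟨fun x hx => by simpa [W] using h1 x hx, fun x => ?_, fun x hx y hy hxy => ?_⟩
      · by_cases hx : x ∈ τ
        · obtain ⟨i | i, rfl⟩ := h1 x hx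
          · refine (hsq τ _).trans ?_
            rw [Sum.elim_inl, hbu]; omega
          · refine (hsq τ _).trans ?_
            rw [Sum.elim_inr, hbv]; omega
        · rw [sqfree_apply, if_neg hx]; exact Nat.zero_le _
      · rw [Finsupp.tsub_apply, Finsupp.tsub_apply]
        obtain ⟨i | i, -, rfl⟩ := Finset.mem_image.1 hx <;>
          obtain ⟨j | j, -, rfl⟩ := Finset.mem_image.1 hy <;>
          simp only [Sum.elim_inl, Sum.elim_inr] at hxy ⊢
        · exact absurd hxy (hind i j)
        · exact huvn i j hxy
        · rw [add_comm]; exact huvn j i hxy.symm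
        · have h3 := hsq τ (v i)
          have h4 := hsq τ (v j)
          rw [hbv, hbv]
          omega) hdz
  refine hz0 ?_
  rw [← hdq]
  suffices q = 0 by rw [this, map_zero]
  ext τ
  by_contra hne
  have hcard : τ.card = s + 1 := by by_contra hc; exact hne (hq τ hc)
  obtain ⟨hτW, hτb, hτ⟩ := hqΔ τ hne
  have hpair : ∀ i, u i ∈ τ → v i ∉ τ := fun i hui hvi => by
    have := hτ (u i) (hτW hui) (v i) (hτW hvi) (hadj i)
    rw [Finsupp.tsub_apply, Finsupp.tsub_apply, sqfree_apply, sqfree_apply, if_pos hui,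
      if_pos hvi, hbu, hbv] at this
    omega
  have hsub : τ ⊆ Finset.univ.image fun i => if u i ∈ τ then u i else v i := fun x hx => by
    obtain ⟨i | i, -, rfl⟩ := Finset.mem_image.1 (hτW hx)
    · exact Finset.mem_image.2 ⟨i, Finset.mem_univ i, if_pos hx⟩
    · exact Finset.mem_image.2 ⟨i, Finset.mem_univ i, if_neg fun h => hpair i h hx⟩
  have := (Finset.card_le_card hsub).trans Finset.card_image_le
  simp only [Finset.card_univ, Fintype.card_fin] at this
  omega

end Nonvanishing

end DS

/-- If `H` is an induced subgraph of `G` with `ν₀(H) = ν₀(G)`, then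
`sdst(J(G)) ≤ sdst(J(H))`, where `J(H)` lives in the polynomial ring on the variables
indexed by the vertices of `H`. -/
theorem stmt_7 (K : Type*) [Field K] {r : ℕ} (G : SimpleGraph (Fin r))
    (hE : G.edgeSet.Nonempty) (S : Finset (Fin r))
    (hnu : DS.nu0 (G.induce (S : Set (Fin r))) = DS.nu0 G) :
    DS.sdst K G ≤ DS.sdst K (G.induce (S : Set (Fin r))) := by
  have hadj : ∃ a b, G.Adj a b := by
    obtain ⟨e, he⟩ := hE
    induction e using Sym2.ind with
    | h a b => exact ⟨a, b, he⟩
  obtain ⟨a, b, hab⟩ := hadj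
  obtain ⟨a', b', hab'⟩ := DS.exists_adj_of_nu0_ne_zero (hnu ▸ DS.nu0_ne_zero hab)
  refine csInf_le_csInf (OrderBot.bddBelow _) ?_ ?_
  · obtain ⟨u, v, huv⟩ := DS.exists_isOrderedMatching_nu0 (G.induce (S : Set (Fin r)))
    refine ⟨2 * DS.nu0 (G.induce (S : Set (Fin r))) + 1, by omega, fun n hn => ?_⟩
    exact (DS.depthQ_symbPow_eq_iff hab' (by omega)).2
      (DS.exists_not_faceExact_coverComplex huv (by omega))
  · rintro n₀ ⟨h1, h⟩
    refine ⟨h1, fun n hn => ?_⟩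
    rw [DS.depthQ_symbPow_eq_iff hab (by omega)]
    obtain ⟨b, hb⟩ := (DS.depthQ_symbPow_eq_iff hab' (by omega)).1 (h n hn)
    by_contra! hall
    rw [hnu] at hb
    exact hb (DS.faceExact_coverComplex_comap (OrderEmbedding.subtype (· ∈ (S : Set (Fin r))))
      (DS.faceExact_coverComplex_of_univ hall _) b)
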